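/- arXiv:1602.04517 — 4 statements merged into one kernel-verified Lean document; each statement's English description precedes it below -/
import Mathlib

section
/- Let k be an algebraically closed field of characteristic 0 and let L = k((t)) be the field of formal Laurent series over k. Then every finite field extension L'/L of degree n is obtained by adjoining an n-th root of t: there exists x ∈ L' with x^n = t (where t is viewed in L' via the structure map) such that L' is generated over L by x. -/
open PowerSeries

theorem aux_precomplete {A M : Type*} [CommRing A] [AddCommGroup M] [Module A M]
    [Module.Free A M] [Module.Finite A M] (I : Ideal A) [IsPrecomplete I A] :
    IsPrecomplete I M := by
  constructor
  intro f hf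
  let b := Module.Free.chooseBasis A M
  have h1 : ∀ i, ∃ L : A, ∀ n, b.coord i (f n) ≡ L [SMOD (I ^ n • ⊤ : Submodule A A)] := by
    intro i
    apply IsPrecomplete.prec' (I := I)
    intro m n hmn
    have := hf hmn
    rw [SModEq.sub_mem] at this ⊢
    rw [← map_sub]
    have h2 := Submodule.mem_map_of_mem (f := b.coord i) this
    rw [Submodule.map_smul''] at h2
    exact Submodule.smul_mono le_rfl le_top h2
  choose L hL using h1
  refine ⟨∑ i, L i • b i, fun n => ?_⟩
  rw [SModEq.sub_mem]
  have h3 : f n = ∑ i, b.repr (f n) i • b i := (b.sum_repr (f n)).symm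
  rw [h3, ← Finset.sum_sub_distrib]
  refine Submodule.sum_mem _ fun i _ => ?_
  rw [← sub_smul]
  refine Submodule.smul_mem_smul ?_ trivial
  have := hL i n
  rw [SModEq.sub_mem] at this
  simpa using this

theorem aux_isLocalRing {R : Type*} [CommRing R] [IsDomain R] (J : Ideal R) [IsAdicComplete J R]
    [IsArtinianRing (R ⧸ J)] : IsLocalRing R := by
  have hloc := isLocalHom_of_le_jacobson_bot J (IsAdicComplete.le_jacobson_bot J)
  apply IsLocalRing.of_isUnit_or_isUnit_one_sub_self
  intro b
  set q := Ideal.Quotient.mk J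
  obtain ⟨n, y, hy⟩ := IsArtinian.exists_pow_succ_smul_dvd (q b) (1 : R ⧸ J)
  obtain ⟨y, rfl⟩ := Ideal.Quotient.mk_surjective y
  simp only [smul_eq_mul, mul_one] at hy
  change q b ^ (n+1) * q y = q b ^ n at hy
  have hy' : ∀ m, q b ^ (n + m) * q y ^ m = q b ^ n := by
    intro m
    induction m with
    | zero => simp
    | succ m ih =>
      calc q b ^ (n + (m+1)) * q y ^ (m+1) = (q b ^ (n+1) * q y) * (q b ^ m * q y ^ m) := by ring
        _ = q b ^ n := by rw [hy, ← mul_assoc, ← pow_add, ih]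
  have h2 : q (b ^ (n+1) * y ^ (n+1)) * q (b ^ (n+1) * y ^ (n+1)) = q (b ^ (n+1) * y ^ (n+1)) := by
    have := hy' (n+1)
    simp only [map_mul, map_pow]
    calc _ = (q b ^ (n + (n+1)) * q y ^ (n+1)) * q b * q y ^ (n+1) := by ring
      _ = _ := by rw [this]; ring
  set e := b ^ (n+1) * y ^ (n+1) with he
  obtain ⟨a, ha, hae⟩ := HenselianRing.is_henselian (I := J)
    (Polynomial.X ^ 2 - Polynomial.X : Polynomial R)
    (Polynomial.monic_X_pow_sub (by simp)) e (by
      rw [← Ideal.Quotient.eq_zero_iff_mem]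
      simp [pow_two]
      exact sub_eq_zero.2 h2) (by
      apply IsUnit.of_mul_eq_one (Ideal.Quotient.mk J (2 * e - 1))
      simp only [Polynomial.derivative_sub, Polynomial.derivative_X_pow, Polynomial.derivative_X,
        Polynomial.eval_sub, Polynomial.eval_mul, Polynomial.eval_C, Polynomial.eval_pow,
        Polynomial.eval_X, Polynomial.eval_one, map_sub, map_mul, map_one, map_pow, Nat.cast_ofNat,
        map_ofNat, Polynomial.eval_ofNat]
      change (2 * q e ^ (2 - 1) - 1) * (2 * q e - 1) = 1
      linear_combination 4 * h2)
  have ha' : a * (a - 1) = 0 := by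
    simp [Polynomial.IsRoot] at ha
    linear_combination ha
  rw [← Ideal.Quotient.eq_zero_iff_mem, map_sub, sub_eq_zero] at hae
  rcases mul_eq_zero.1 ha' with h | h
  · right
    apply IsUnit.of_map q
    rw [h, map_zero] at hae
    have h0 : q b ^ n = 0 := by
      rw [← hy' (n+1)]
      calc _ = q b ^ n * q e := by simp [he]; ring
        _ = 0 := by rw [← hae]; simp
    rw [map_sub, map_one]
    exact IsNilpotent.isUnit_one_sub ⟨n, h0⟩
  · left
    apply IsUnit.of_map q
    rw [sub_eq_zero.1 h, map_one] at hae
    apply IsUnit.of_mul_eq_one (q b ^ n * q y ^ (n+1))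
    change 1 = q e at hae
    rw [hae]
    simp [he]; ring

theorem aux_complete_max {R : Type*} [CommRing R] [IsLocalRing R] [IsNoetherianRing R]
    (J : Ideal R) [IsPrecomplete J R] (e : ℕ) (he : 0 < e)
    (hJ : J = IsLocalRing.maximalIdeal R ^ e) : IsAdicComplete (IsLocalRing.maximalIdeal R) R where
  prec' := by
    intro f hf
    obtain ⟨L, hL⟩ := IsPrecomplete.prec' (I := J) (fun n => f (e * n)) (by
      intro m n hmn
      rw [hJ, ← pow_mul]
      exact hf (Nat.mul_le_mul_left e hmn))
    refine ⟨L, fun n => ?_⟩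
    have h1 : n ≤ e * n := Nat.le_mul_of_pos_left n he
    refine (hf h1).trans ?_
    refine SModEq.mono ?_ (hL n)
    rw [hJ, ← pow_mul]
    exact Submodule.smul_mono_left (Ideal.pow_le_pow_right h1)

theorem aux_artinian {A B : Type*} [CommRing A] [CommRing B] [Algebra A B] [Module.Finite A B]
    (I : Ideal A) [I.IsMaximal] : IsArtinianRing (B ⧸ I.map (algebraMap A B)) := by
  let _ := Ideal.Quotient.field I
  have : Module.Finite (A ⧸ I) (B ⧸ I.map (algebraMap A B)) :=
    Module.Finite.of_restrictScalars_finite A (A ⧸ I) _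
  exact IsArtinianRing.of_finite (A ⧸ I) _

theorem aux_spanX_max (k : Type*) [Field k] : (Ideal.span {(X : k⟦X⟧)}).IsMaximal := by
  rw [← PowerSeries.maximalIdeal_eq_span_X]
  infer_instance

theorem aux_residue {k : Type*} [Field k] [IsAlgClosed k] {B : Type*} [CommRing B]
    [Algebra k⟦X⟧ B] [Module.Finite k⟦X⟧ B] [IsLocalRing B]
    (hX : algebraMap k⟦X⟧ B X ∈ IsLocalRing.maximalIdeal B) (b : B) :
    ∃ c : k, b - algebraMap k⟦X⟧ B (C c) ∈ IsLocalRing.maximalIdeal B := by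
  let r := IsLocalRing.residue B
  let φ : k →+* IsLocalRing.ResidueField B := r.comp ((algebraMap k⟦X⟧ B).comp C)
  have hφ : r.comp (algebraMap k⟦X⟧ B) = φ.comp constantCoeff := by
    ext p
    have h := PowerSeries.sub_const_eq_X_mul_shift p
    have h' : p = C (constantCoeff p) + X * (PowerSeries.mk fun i => coeff (i+1) p) := by
      rw [← h]; ring
    have h0 : r (algebraMap k⟦X⟧ B X) = 0 := (IsLocalRing.residue_eq_zero_iff _).2 hX
    conv_lhs => rw [h']
    simp [φ, h0]
  have hint : φ.IsIntegral := by
    intro z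
    obtain ⟨b, rfl⟩ := IsLocalRing.residue_surjective z
    obtain ⟨p, hp, hpb⟩ := Algebra.IsIntegral.isIntegral (R := k⟦X⟧) b
    refine ⟨p.map constantCoeff, hp.map _, ?_⟩
    rw [Polynomial.eval₂_map, ← hφ]
    change Polynomial.eval₂ (r.comp _) (r b) p = 0
    rw [← Polynomial.hom_eval₂, hpb, map_zero]
  obtain ⟨c, hc⟩ := (IsAlgClosed.ringHom_bijective_of_isIntegral φ hint).2 (r b)
  refine ⟨c, ?_⟩
  rw [← IsLocalRing.residue_eq_zero_iff, map_sub, sub_eq_zero]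
  exact hc.symm

theorem aux_root {k : Type*} [Field k] [IsAlgClosed k] [CharZero k] {B : Type*} [CommRing B]
    [Algebra k⟦X⟧ B] [Module.Finite k⟦X⟧ B] [IsLocalRing B]
    [IsAdicComplete (IsLocalRing.maximalIdeal B) B]
    (hX : algebraMap k⟦X⟧ B X ∈ IsLocalRing.maximalIdeal B) (u : B) (hu : IsUnit u)
    (e : ℕ) (he : 0 < e) : ∃ v : B, v ^ e = u := by
  obtain ⟨c, hc⟩ := aux_residue hX u
  obtain ⟨d, hd⟩ := IsAlgClosed.exists_pow_nat_eq c he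
  have hd0 : d ≠ 0 := by
    rintro rfl
    rw [zero_pow he.ne'] at hd
    rw [← hd, map_zero, map_zero, sub_zero] at hc
    exact hc hu
  obtain ⟨a, ha, -⟩ := HenselianRing.is_henselian (I := IsLocalRing.maximalIdeal B)
    (Polynomial.X ^ e - Polynomial.C u : Polynomial B)
    (Polynomial.monic_X_pow_sub_C u he.ne') (algebraMap k⟦X⟧ B (C d)) (by
      rw [← neg_mem_iff]
      simpa [← map_pow, hd] using hc) (by
      apply IsUnit.map
      have h1 : (algebraMap k⟦X⟧ B (C ((e : k) * d ^ (e-1)))) =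
        Polynomial.eval (algebraMap k⟦X⟧ B (C d))
          (Polynomial.derivative (Polynomial.X ^ e - Polynomial.C u)) := by
        simp [Polynomial.derivative_X_pow]
      rw [← h1]
      apply IsUnit.map
      apply IsUnit.map
      exact IsUnit.mk0 _ (mul_ne_zero (Nat.cast_ne_zero.2 he.ne') (pow_ne_zero _ hd0)))
  refine ⟨a, ?_⟩
  simpa [Polynomial.IsRoot, sub_eq_zero] using ha

theorem aux_main {k : Type*} [Field k] [IsAlgClosed k] [CharZero k] {B : Type*} [CommRing B]
    [IsDedekindDomain B] [Algebra k⟦X⟧ B] [Module.Finite k⟦X⟧ B] [FaithfulSMul k⟦X⟧ B] :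
    ∃ (x : B) (e : ℕ), 0 < e ∧ x ^ e = algebraMap k⟦X⟧ B X ∧ Algebra.adjoin k⟦X⟧ {x} = ⊤ := by
  have hinj := FaithfulSMul.algebraMap_injective k⟦X⟧ B
  have hmax := aux_spanX_max k
  set I : Ideal k⟦X⟧ := Ideal.span {X} with hI
  set J := I.map (algebraMap k⟦X⟧ B) with hJ
  have hJs : J = Ideal.span {algebraMap k⟦X⟧ B X} := by
    rw [hJ, hI, Ideal.map_span, Set.image_singleton]
  have : Module.IsTorsionFree k⟦X⟧ B := inferInstance
  have : Module.Free k⟦X⟧ B := Module.free_of_finite_type_torsion_free'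
  have hpre0 : IsPrecomplete I B := aux_precomplete I
  have hpre : IsPrecomplete J B := IsPrecomplete.map_algebraMap_iff.2 hpre0
  have hnu : ¬ IsUnit (algebraMap k⟦X⟧ B X) := by
    intro h
    have h1 : IsLocalHom (algebraMap k⟦X⟧ B) := inferInstance
    have h2 := h1.map_nonunit _ h
    exact PowerSeries.X_prime.not_isUnit h2
  have hJtop : J ≠ ⊤ := by
    rw [hJs]
    rwa [Ne, Ideal.span_singleton_eq_top]
  have hh : IsHausdorff J B := IsHausdorff.of_isDomain J hJtop
  have hcomp : IsAdicComplete J B := {}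
  have hart : IsArtinianRing (B ⧸ J) := aux_artinian I
  have hlocal : IsLocalRing B := aux_isLocalRing J
  have hX0 : algebraMap k⟦X⟧ B X ≠ 0 := by
    rw [Ne, map_eq_zero_iff _ hinj]
    exact PowerSeries.X_ne_zero
  have hXm : algebraMap k⟦X⟧ B X ∈ IsLocalRing.maximalIdeal B := hnu
  have hnf : ¬ IsField B := fun h => by
    obtain ⟨c, hc⟩ := h.mul_inv_cancel hX0
    exact hnu (IsUnit.of_mul_eq_one c hc)
  have hded : IsDedekindDomain B := inferInstance
  have hdvr : IsDiscreteValuationRing B :=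
    ((IsDiscreteValuationRing.TFAE B hnf).out 0 2).2 hded
  obtain ⟨ϖ, hϖ⟩ := IsDiscreteValuationRing.exists_irreducible B
  obtain ⟨e, u, hu⟩ := IsDiscreteValuationRing.eq_unit_mul_pow_irreducible hX0 hϖ
  have he : 0 < e := by
    rcases Nat.eq_zero_or_pos e with h | h
    · exfalso; apply hnu; rw [hu, h]; simp
    · exact h
  have hJm : J = IsLocalRing.maximalIdeal B ^ e := by
    rw [hJs, hϖ.maximalIdeal_eq, Ideal.span_singleton_pow, hu, mul_comm]
    exact Ideal.span_singleton_mul_right_unit u.isUnit _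
  have hc2 := aux_complete_max J e he hJm
  obtain ⟨v, hv⟩ := aux_root hXm u u.isUnit e he
  have hvu : IsUnit v := by
    rw [← isUnit_pow_iff he.ne', hv]; exact u.isUnit
  have hxe : (v * ϖ) ^ e = algebraMap k⟦X⟧ B X := by rw [mul_pow, hv, hu]
  refine ⟨v * ϖ, e, he, hxe, ?_⟩
  set x := v * ϖ with hx
  have hxm : IsLocalRing.maximalIdeal B = Ideal.span {x} := by
    rw [hϖ.maximalIdeal_eq, hx, mul_comm]
    exact (Ideal.span_singleton_mul_right_unit hvu _).symm
  have hstep : ∀ j : ℕ, ∀ b : B, ∃ s ∈ Algebra.adjoin k⟦X⟧ {x}, ∃ b', b = s + x ^ j * b' := by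
    intro j
    induction j with
    | zero => exact fun b => ⟨0, zero_mem _, b, by simp⟩
    | succ j ih =>
      intro b
      obtain ⟨s, hs, b', rfl⟩ := ih b
      obtain ⟨c, hc⟩ := aux_residue hXm b'
      rw [hxm, Ideal.mem_span_singleton] at hc
      obtain ⟨b'', hb⟩ := hc
      refine ⟨s + x ^ j * algebraMap k⟦X⟧ B (C c), ?_, b'', ?_⟩
      · exact add_mem hs (mul_mem (pow_mem (Algebra.self_mem_adjoin_singleton _ _) _)
          (Subalgebra.algebraMap_mem _ _))
      · linear_combination x ^ j * hb
  have hnak : (⊤ : Submodule k⟦X⟧ B) ≤ Subalgebra.toSubmodule (Algebra.adjoin k⟦X⟧ {x}) := by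
    apply Submodule.le_of_le_smul_of_le_jacobson_bot (I := I) Module.Finite.fg_top
    · exact IsAdicComplete.le_jacobson_bot I
    · intro b _
      obtain ⟨s, hs, b', rfl⟩ := hstep e b
      refine Submodule.add_mem_sup hs ?_
      rw [hxe, ← Algebra.smul_def]
      exact Submodule.smul_mem_smul (Ideal.mem_span_singleton_self _) trivial
  exact eq_top_iff.2 fun b hb => hnak hb

theorem aux_irred (k : Type*) [Field k] (e : ℕ) (he : 0 < e) :
    Irreducible (Polynomial.X ^ e - Polynomial.C (algebraMap k⟦X⟧ (LaurentSeries k) X)) := by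
  have hm : (Polynomial.X ^ e - Polynomial.C X : Polynomial k⟦X⟧).Monic :=
    Polynomial.monic_X_pow_sub_C _ he.ne'
  have h : Irreducible (Polynomial.X ^ e - Polynomial.C X : Polynomial k⟦X⟧) := by
    have hmax := aux_spanX_max k
    refine Polynomial.IsEisensteinAt.irreducible (𝓟 := Ideal.span {X}) ?_ hmax.isPrime
      hm.isPrimitive (by rwa [Polynomial.natDegree_X_pow_sub_C])
    refine ⟨?_, ?_, ?_⟩
    · rw [hm.leadingCoeff]
      exact fun h => hmax.ne_top ((Ideal.eq_top_iff_one _).2 h)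
    · intro n hn
      rw [Polynomial.natDegree_X_pow_sub_C] at hn
      simp only [Polynomial.coeff_sub, Polynomial.coeff_X_pow, if_neg hn.ne, zero_sub, neg_mem_iff,
        Polynomial.coeff_C]
      split_ifs
      · exact Ideal.mem_span_singleton_self _
      · exact zero_mem _
    · simp only [Polynomial.coeff_sub, Polynomial.coeff_X_pow, if_neg he.ne, zero_sub, neg_mem_iff,
        Polynomial.coeff_C_zero, Ideal.span_singleton_pow, Ideal.mem_span_singleton]
      intro h
      have := (PowerSeries.X_pow_dvd_iff.1 h) 1 (by norm_num)
      simp at this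
  have := (hm.irreducible_iff_irreducible_map_fraction_map (K := LaurentSeries k)).1 h
  simpa using this

theorem finite_extension_of_laurentSeries_is_radical
    (k : Type*) [Field k] [IsAlgClosed k] [CharZero k]
    (L' : Type*) [Field L'] [Algebra (LaurentSeries k) L']
    [FiniteDimensional (LaurentSeries k) L']
    (n : ℕ) (hn : Module.finrank (LaurentSeries k) L' = n) :
    ∃ x : L',
      x ^ n = algebraMap (LaurentSeries k) L'
        ((PowerSeries.X : PowerSeries k) : LaurentSeries k) ∧
      Algebra.adjoin (LaurentSeries k) {x} = ⊤ := by
  let _ : Algebra k⟦X⟧ L' := Algebra.compHom L' (algebraMap k⟦X⟧ (LaurentSeries k))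
  have : IsScalarTower k⟦X⟧ (LaurentSeries k) L' := IsScalarTower.of_algebraMap_eq fun _ => rfl
  have : CharZero (LaurentSeries k) :=
    charZero_of_injective_algebraMap (algebraMap k (LaurentSeries k)).injective
  have hinj : Function.Injective (algebraMap k⟦X⟧ L') :=
    (algebraMap (LaurentSeries k) L').injective.comp (IsFractionRing.injective k⟦X⟧ _)
  have : FaithfulSMul k⟦X⟧ L' := (faithfulSMul_iff_algebraMap_injective _ _).2 hinj
  have : IsDedekindDomain (integralClosure k⟦X⟧ L') :=
    integralClosure.isDedekindDomain k⟦X⟧ (LaurentSeries k) L'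
  have : Module.Finite k⟦X⟧ (integralClosure k⟦X⟧ L') :=
    IsIntegralClosure.finite k⟦X⟧ (LaurentSeries k) L' _
  have : FaithfulSMul k⟦X⟧ (integralClosure k⟦X⟧ L') := inferInstance
  obtain ⟨x, e, he, hxe, hadj⟩ := aux_main (k := k) (B := integralClosure k⟦X⟧ L')
  have hxe' : (x : L') ^ e = algebraMap (LaurentSeries k) L' (algebraMap k⟦X⟧ (LaurentSeries k) X) := by
    have := congrArg (algebraMap (integralClosure k⟦X⟧ L') L') hxe
    rw [map_pow, ← IsScalarTower.algebraMap_apply] at this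
    exact this
  have htop : Algebra.adjoin (LaurentSeries k) {(x : L')} = ⊤ := by
    have hB : ∀ b : integralClosure k⟦X⟧ L', (b : L') ∈ Algebra.adjoin (LaurentSeries k) {(x : L')} := by
      intro b
      have hb : b ∈ Algebra.adjoin k⟦X⟧ {x} := hadj ▸ Algebra.mem_top
      induction hb using Algebra.adjoin_induction with
      | mem y hy =>
        rw [Set.mem_singleton_iff.1 hy]
        exact Algebra.self_mem_adjoin_singleton _ _
      | algebraMap r =>
        exact Subalgebra.algebraMap_mem _ (algebraMap k⟦X⟧ (LaurentSeries k) r)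
      | add y z _ _ hy hz => exact add_mem hy hz
      | mul y z _ _ hy hz => exact mul_mem hy hz
    rw [eq_top_iff]
    intro y _
    have hal : IsAlgebraic k⟦X⟧ y :=
      (IsFractionRing.isAlgebraic_iff k⟦X⟧ (LaurentSeries k) L').2 (Algebra.IsAlgebraic.isAlgebraic y)
    obtain ⟨a, ha, hay⟩ := hal.exists_integral_multiple
    have h1 := hB ⟨a • y, hay⟩
    change a • y ∈ _ at h1
    have ha' : algebraMap k⟦X⟧ (LaurentSeries k) a ≠ 0 := by
      rwa [Ne, map_eq_zero_iff _ (IsFractionRing.injective k⟦X⟧ _)]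
    rw [← algebraMap_smul (LaurentSeries k) a y] at h1
    have h2 := Subalgebra.smul_mem _ h1 (algebraMap k⟦X⟧ (LaurentSeries k) a)⁻¹
    rwa [inv_smul_smul₀ ha'] at h2
  have hmin : Polynomial.X ^ e - Polynomial.C (algebraMap k⟦X⟧ (LaurentSeries k) X)
      = minpoly (LaurentSeries k) (x : L') := by
    apply minpoly.eq_of_irreducible_of_monic (aux_irred k e he)
    · simp [hxe']
    · exact Polynomial.monic_X_pow_sub_C _ he.ne'
  have hif : IntermediateField.adjoin (LaurentSeries k) {(x : L')} = ⊤ := by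
    rw [eq_top_iff]
    intro y _
    apply IntermediateField.algebra_adjoin_le_adjoin
    rw [htop]; trivial
  have hdeg := (Field.primitive_element_iff_minpoly_natDegree_eq _ _).1 hif
  rw [← hmin, Polynomial.natDegree_X_pow_sub_C, hn] at hdeg
  subst hdeg
  exact ⟨x, hxe', htop⟩
end

section
/- Let K be a perfect field such that for every integer n ≥ 1 the absolute Galois group Gal(K̄/K) has only finitely many open subgroups of index n (i.e., K is of type (F)). Then for every integer m ≥ 1 prime to the characteristic of K and every finite extension L/K, the quotient group Lˣ/(Lˣ)^m is finite. -/
universe u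

/-- If `K` is a perfect field of type (F) (finitely many open subgroups of each finite index
in the absolute Galois group), then for every `m ≥ 1` invertible in `K` and every finite
extension `L/K`, the group `Lˣ/(Lˣ)^m` is finite. -/
theorem finite_units_quotient_pow_of_typeF
    (K : Type u) [Field K] [PerfectField K]
    (hF : ∀ n : ℕ, 1 ≤ n →
      {H : Subgroup (AlgebraicClosure K ≃ₐ[K] AlgebraicClosure K) |
        IsOpen (H : Set (AlgebraicClosure K ≃ₐ[K] AlgebraicClosure K)) ∧ H.index = n}.Finite)
    (m : ℕ) (hm : 1 ≤ m) (hmK : (m : K) ≠ 0)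
    (L : Type u) [Field L] [Algebra K L] [FiniteDimensional K L] :
    Finite (Lˣ ⧸ (powMonoidHom m : Lˣ →* Lˣ).range) := by
  classical
  have hm0 : m ≠ 0 := by omega
  set Ω := AlgebraicClosure K with hΩ
  let φ : L →ₐ[K] Ω := IsAlgClosed.lift
  let : Algebra L Ω := φ.toRingHom.toAlgebra
  have : IsScalarTower K L Ω := IsScalarTower.of_algebraMap_eq fun x => (φ.commutes x).symm
  have : Algebra.IsAlgebraic L Ω := Algebra.IsAlgebraic.tower_top (K := K) L
  have : PerfectField L := Algebra.IsAlgebraic.perfectField (K := K) (L := L)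
  have : IsGalois K Ω := { }
  have : IsGalois L Ω := { to_normal := Normal.tower_top_of_normal K L Ω, to_isSeparable := inferInstance }
  -- choose roots
  have hroot : ∀ a : Lˣ, ∃ α : Ω, α ^ m = algebraMap L Ω a := fun a =>
    IsAlgClosed.exists_pow_nat_eq _ (by omega)
  choose α hα using hroot
  have hα0 : ∀ a, α a ≠ 0 := by
    intro a h
    have := hα a
    rw [h, zero_pow hm0] at this
    exact a.ne_zero ((map_eq_zero (algebraMap L Ω)).1 this.symm)
  -- degrees
  have hint : ∀ x : Ω, IsIntegral K x := fun x => Algebra.IsIntegral.isIntegral x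
  have hdeg : ∀ a, Module.finrank K (IntermediateField.adjoin K {α a}) ≤ Module.finrank K L * m := by
    intro a
    rw [IntermediateField.adjoin.finrank (hint _)]
    have h1 : (minpoly K (α a)) ∣ (Polynomial.expand K m (minpoly K (a : L))) := by
      apply minpoly.dvd
      rw [Polynomial.expand_aeval, hα, Polynomial.aeval_algebraMap_apply, minpoly.aeval, map_zero]
    have hne : minpoly K (a : L) ≠ 0 := minpoly.ne_zero (Algebra.IsIntegral.isIntegral _)
    have h2 := Polynomial.natDegree_le_of_dvd h1 ((Polynomial.expand_ne_zero (by omega)).2 hne)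
    rw [Polynomial.natDegree_expand] at h2
    exact h2.trans (Nat.mul_le_mul_right _ (minpoly.natDegree_le _))
  have hfd : ∀ a, FiniteDimensional K (IntermediateField.adjoin K {α a}) := fun a =>
    IntermediateField.adjoin.finiteDimensional (hint _)
  -- finitely many fields
  have hfin : (Set.range fun a => IntermediateField.adjoin K {α a}).Finite := by
    have hU : (⋃ n ∈ Set.Icc 1 (Module.finrank K L * m),
      {H : Subgroup (Ω ≃ₐ[K] Ω) | IsOpen (H : Set (Ω ≃ₐ[K] Ω)) ∧ H.index = n}).Finite :=
      Set.Finite.biUnion (Set.finite_Icc _ _) fun n hn => hF n hn.1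
    have hinj : Function.Injective (fun E : IntermediateField K Ω => E.fixingSubgroup) := by
      intro E E' h
      have := congrArg IntermediateField.fixedField h
      simpa only [InfiniteGalois.fixedField_fixingSubgroup] using this
    refine Set.Finite.of_finite_image (f := fun E : IntermediateField K Ω => E.fixingSubgroup)
      (hU.subset ?_) hinj.injOn
    rintro _ ⟨_, ⟨a, rfl⟩, rfl⟩
    have := hfd a
    simp only [Set.mem_iUnion]
    refine ⟨Module.finrank K (IntermediateField.adjoin K {α a}),
      ⟨Module.finrank_pos, hdeg a⟩, ?_, ?_⟩
    · exact IntermediateField.fixingSubgroup_isOpen _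
    · exact (IntermediateField.finrank_eq_fixingSubgroup_index _ _).symm
  have : Finite (Set.range fun a => IntermediateField.adjoin K {α a}) := hfin
  let E : IntermediateField K Ω := ⨆ F : (Set.range fun a => IntermediateField.adjoin K {α a}), F.1
  have : FiniteDimensional K E := by
    have : ∀ F : (Set.range fun a => IntermediateField.adjoin K {α a}),
        FiniteDimensional K F.1 := by
      rintro ⟨_, ⟨a, rfl⟩⟩; exact hfd a
    exact IntermediateField.finiteDimensional_iSup_of_finite
  have hαE : ∀ a, α a ∈ E := fun a =>
    (le_iSup (fun F : (Set.range fun a => IntermediateField.adjoin K {α a}) => F.1) ⟨_, a, rfl⟩)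
      (IntermediateField.mem_adjoin_simple_self K (α a))
  let r : (Ω ≃ₐ[L] Ω) → (E →ₐ[K] Ω) := fun σ =>
    ((σ : Ω →ₐ[L] Ω).restrictScalars K).comp E.val
  have hr : ∀ σ a, r σ ⟨α a, hαE a⟩ = σ (α a) := fun _ _ => rfl
  have : Finite (E →ₐ[K] Ω) := inferInstance
  have : Finite {x : Ω // x ^ m = 1} := by
    have : {x : Ω | x ^ m = 1}.Finite := by
      refine (Polynomial.nthRootsFinset m (1 : Ω)).finite_toSet.subset ?_
      intro x hx
      exact (Polynomial.mem_nthRootsFinset (by omega) 1).2 hx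
    exact this
  let c : Lˣ → (Set.range r → {x : Ω // x ^ m = 1}) := fun a s =>
    ⟨s.1 ⟨α a, hαE a⟩ / α a, by
      obtain ⟨_, ⟨σ, rfl⟩⟩ := s
      rw [hr, div_pow, ← map_pow, hα, AlgEquiv.commutes, div_self]
      rw [← hα]; exact pow_ne_zero _ (hα0 a)⟩
  have key : ∀ a b, c a = c b → (a : Lˣ ⧸ (powMonoidHom m : Lˣ →* Lˣ).range) = b := by
    intro a b hab
    have h1 : ∀ σ : Ω ≃ₐ[L] Ω, σ (α b / α a) = α b / α a := by
      intro σ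
      have h := congrArg Subtype.val (congrFun hab ⟨r σ, σ, rfl⟩)
      change σ (α a) / α a = σ (α b) / α b at h
      have := hα0 a
      have := hα0 b
      have hs : σ (α a) ≠ 0 := (map_ne_zero σ).2 (hα0 a)
      rw [map_div₀]
      rw [div_eq_div_iff (hα0 _) (hα0 _)] at h
      rw [div_eq_div_iff hs (hα0 _)]
      linear_combination -h
    obtain ⟨x, hx⟩ : α b / α a ∈ Set.range (algebraMap L Ω) := 
      (InfiniteGalois.mem_range_algebraMap_iff_fixed _).2 h1
    have hx0 : x ≠ 0 := by
      rintro rfl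
      rw [map_zero] at hx
      exact div_ne_zero (hα0 b) (hα0 a) hx.symm
    rw [QuotientGroup.eq]
    refine ⟨Units.mk0 x hx0, ?_⟩
    rw [eq_inv_mul_iff_mul_eq]
    ext
    apply (algebraMap L Ω).injective
    simp only [powMonoidHom_apply, Units.val_mul, Units.val_pow_eq_pow_val, Units.val_mk0, map_mul,
      map_pow, hx, ← hα]
    rw [← mul_pow, mul_div_cancel₀ _ (hα0 a)]
  refine Finite.of_injective (fun q : Lˣ ⧸ (powMonoidHom m : Lˣ →* Lˣ).range => c q.out) ?_
  intro p q h
  have := key _ _ h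
  simpa using this
end

section
/- Let p be a prime and m ≥ 1 an integer prime to p. Then for every finite separable field extension L of the Laurent series field 𝔽_p((t)), the quotient group Lˣ/(Lˣ)^m is finite. In other words, 𝔽_p((t)) is of type (F'_m) for every m prime to p. -/
universe u

open TensorProduct in
/-- A finite module over an `I`-adically precomplete ring is precomplete. -/
theorem aux_isPrecomplete_of_finite {A M : Type*} [CommRing A] (I : Ideal A) [IsPrecomplete I A]
    [AddCommGroup M] [Module A M] [Module.Finite A M] : IsPrecomplete I M := by
  rw [← AdicCompletion.of_surjective_iff]
  intro y
  obtain ⟨z, rfl⟩ := AdicCompletion.ofTensorProduct_surjective_of_finite I M y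
  induction z with
  | zero => exact ⟨0, by simp⟩
  | add a b ha hb =>
    obtain ⟨a', ha⟩ := ha
    obtain ⟨b', hb⟩ := hb
    exact ⟨a' + b', by simp [ha, hb]⟩
  | tmul r x =>
    obtain ⟨s, rfl⟩ := AdicCompletion.of_surjective I A r
    refine ⟨s • x, ?_⟩
    rw [AdicCompletion.ofTensorProduct_tmul]
    rw [map_smul]
    ext n
    rfl

/-- Units congruent to `1` are `m`-th powers. -/
theorem aux_unit_pow {B : Type*} [CommRing B] (I : Ideal B) [HenselianRing B I] (m : ℕ)
    (hm : 1 ≤ m) (hu : IsUnit (m : B)) (u : Bˣ) (h : (u : B) - 1 ∈ I) : ∃ v : Bˣ, v ^ m = u := by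
  obtain ⟨a, ha, -⟩ := HenselianRing.is_henselian (I := I) (Polynomial.X ^ m - Polynomial.C (u : B))
    (Polynomial.monic_X_pow_sub_C _ (by omega)) 1
    (by simpa using I.neg_mem h) (by simpa [Polynomial.derivative_X_pow] using hu.map (Ideal.Quotient.mk I))
  have ha' : a ^ m = u := by
    simpa [Polynomial.IsRoot, sub_eq_zero] using ha
  have hau : IsUnit a := by
    rw [← isUnit_pow_iff (n := m) (by omega), ha']
    exact u.isUnit
  exact ⟨hau.unit, Units.ext (by simpa using ha')⟩

theorem aux_main_s7 {B L : Type*} [CommRing B] [IsDomain B] [IsPrincipalIdealRing B] [Field L]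
    [Algebra B L] [IsFractionRing B L] (I : Ideal B) [HenselianRing B I] [Finite (B ⧸ I)]
    (hfin : {P : Ideal B | P.IsMaximal}.Finite) (m : ℕ) (hm : 1 ≤ m) (hu : IsUnit (m : B)) :
    Finite (Lˣ ⧸ (powMonoidHom m : Lˣ →* Lˣ).range) := by
  classical
  have : Finite {P : Ideal B | P.IsMaximal} := hfin
  let ι : Bˣ →* Lˣ := Units.map (algebraMap B L : B →* L)
  let q : Bˣ →* (B ⧸ I)ˣ := Units.map (Ideal.Quotient.mk I : B →* B ⧸ I)
  have : Finite (B ⧸ I)ˣ := inferInstance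
  let S1 : Set Lˣ := Set.range fun c : (B ⧸ I)ˣ => ι (Function.invFun q c)
  let toU : B → Lˣ := fun b => if h : algebraMap B L b = 0 then 1 else Units.mk0 _ h
  let S2 : Set Lˣ := Set.range fun P : {P : Ideal B | P.IsMaximal} =>
    toU (Submodule.IsPrincipal.generator P.1)
  let N : Subgroup Lˣ := Subgroup.closure (S1 ∪ S2) ⊔ (powMonoidHom m : Lˣ →* Lˣ).range
  have hS : ∀ x ∈ S1 ∪ S2, x ∈ N := fun x hx => Subgroup.mem_sup_left (Subgroup.subset_closure hx)
  have hunit : ∀ u : Bˣ, ι u ∈ N := by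
    intro u
    set w := Function.invFun q (q u) with hw
    have hqw : q w = q u := Function.invFun_eq ⟨u, rfl⟩
    obtain ⟨v, hv⟩ := aux_unit_pow I m hm hu (u * w⁻¹) (by
      rw [← Ideal.Quotient.eq, map_one]
      have : q (u * w⁻¹) = 1 := by rw [map_mul, map_inv, hqw, mul_inv_cancel]
      exact congrArg Units.val this)
    have : u = v ^ m * w := by rw [hv]; simp
    rw [this, map_mul, map_pow]
    exact N.mul_mem (Subgroup.mem_sup_right ⟨ι v, rfl⟩) (hS _ (Or.inl ⟨q u, rfl⟩))
  have hB : ∀ b : B, toU b ∈ N := by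
    intro b
    induction b using UniqueFactorizationMonoid.induction_on_prime with
    | h₁ => simp [toU, N.one_mem]
    | h₂ x hx =>
      obtain ⟨u, rfl⟩ := hx
      have : toU u = ι u := by
        have h0 : algebraMap B L u ≠ 0 := (ι u).ne_zero
        simp only [toU, dif_neg h0]
        exact Units.ext rfl
      rw [this]; exact hunit u
    | h₃ a p ha hp ih =>
      have hmul : ∀ x y : B, x ≠ 0 → y ≠ 0 → toU (x * y) = toU x * toU y := by
        intro x y hx hy
        have hx' : algebraMap B L x ≠ 0 := by simpa using hx
        have hy' : algebraMap B L y ≠ 0 := by simpa using hy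
        have hxy : algebraMap B L (x * y) ≠ 0 := by simp [hx, hy]
        simp only [toU, dif_neg hx', dif_neg hy', dif_neg hxy]
        exact Units.ext (by simp)
      rw [hmul _ _ hp.ne_zero ha]
      refine N.mul_mem ?_ ih
      have hmax : (Ideal.span {p}).IsMaximal :=
        PrincipalIdealRing.isMaximal_of_irreducible hp.irreducible
      set g := Submodule.IsPrincipal.generator (Ideal.span {p}) with hg
      have hass : Associated g p := by
        rw [← Ideal.span_singleton_eq_span_singleton, hg, Ideal.span_singleton_generator]
      have hgm : toU g ∈ N := hS _ (Or.inr ⟨⟨_, hmax⟩, rfl⟩)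
      obtain ⟨u, hu'⟩ := hass
      rw [← hu', hmul _ _ (by rintro h; rw [h, zero_mul] at hu'; exact hp.ne_zero hu'.symm) u.ne_zero]
      refine N.mul_mem hgm ?_
      have : toU u = ι u := by
        have h0 : algebraMap B L u ≠ 0 := (ι u).ne_zero
        simp only [toU, dif_neg h0]
        exact Units.ext rfl
      rw [this]; exact hunit u
  have htop : N = ⊤ := by
    rw [eq_top_iff]
    intro x _
    obtain ⟨a, b, hb, hab⟩ := IsFractionRing.div_surjective (A := B) (x : L)
    have hb0 : algebraMap B L b ≠ 0 := by simpa using nonZeroDivisors.ne_zero hb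
    have ha0 : algebraMap B L a ≠ 0 := by
      intro h; rw [h, zero_div] at hab; exact x.ne_zero hab.symm
    have : x = toU a / toU b := by
      simp only [toU, dif_neg hb0, dif_neg ha0]
      exact Units.ext (by simp [← hab])
    rw [this]
    exact N.div_mem (hB a) (hB b)
  have hSfin : (S1 ∪ S2).Finite := (Set.finite_range _).union (Set.finite_range _)
  have hfg : Group.FG (Lˣ ⧸ (powMonoidHom m : Lˣ →* Lˣ).range) := by
    rw [Group.fg_iff]
    refine ⟨Set.image (QuotientGroup.mk' _) (S1 ∪ S2), ?_, hSfin.image _⟩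
    rw [← MonoidHom.map_closure, eq_top_iff]
    intro y _
    obtain ⟨x, rfl⟩ := QuotientGroup.mk'_surjective _ y
    have hx : x ∈ N := htop ▸ Subgroup.mem_top x
    obtain ⟨s, hs, t, ht, rfl⟩ := Subgroup.mem_sup.1 hx
    refine ⟨s, hs, ?_⟩
    refine QuotientGroup.eq.2 ?_
    rwa [inv_mul_cancel_left]
  refine CommGroup.finite_of_fg_isMulTorsion _ fun y => ?_
  obtain ⟨x, rfl⟩ := QuotientGroup.mk'_surjective _ y
  rw [isOfFinOrder_iff_pow_eq_one]
  refine ⟨m, hm, ?_⟩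
  rw [← map_pow]
  exact (QuotientGroup.eq_one_iff _).2 ⟨x, rfl⟩

/-- The Laurent series field `𝔽_p((t))` is of type (F'_m) for every `m` prime to `p`:
for every finite separable extension `L` of `𝔽_p((t))`, the group `Lˣ/(Lˣ)^m` is finite. -/
theorem laurentSeries_zmod_type_F'
    (p : ℕ) [Fact p.Prime] (m : ℕ) (hm : 1 ≤ m) (hmp : Nat.Coprime m p)
    (L : Type u) [Field L] [Algebra (LaurentSeries (ZMod p)) L]
    [FiniteDimensional (LaurentSeries (ZMod p)) L]
    [Algebra.IsSeparable (LaurentSeries (ZMod p)) L] :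
    Finite (Lˣ ⧸ (powMonoidHom m : Lˣ →* Lˣ).range) := by
  let A := PowerSeries (ZMod p)
  let K := LaurentSeries (ZMod p)
  let : Algebra A L := ((algebraMap K L).comp (algebraMap A K)).toAlgebra
  have : IsScalarTower A K L := IsScalarTower.of_algebraMap_eq' rfl
  let B := integralClosure A L
  have : Module.Finite A B := IsIntegralClosure.finite A K L B
  have : IsDedekindDomain B := IsIntegralClosure.isDedekindDomain A K L B
  have : IsFractionRing B L := integralClosure.isFractionRing_of_finite_extension K L
  let J : Ideal A := IsLocalRing.maximalIdeal A
  have hJ : J = Ideal.span {PowerSeries.X} := PowerSeries.maximalIdeal_eq_span_X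
  have : IsAdicComplete J A := by rw [hJ]; infer_instance
  have : IsPrecomplete J B := aux_isPrecomplete_of_finite J
  have : IsHausdorff J B := inferInstance
  have : IsAdicComplete J B := ⟨⟩
  let I : Ideal B := J.map (algebraMap A B)
  have : IsAdicComplete I B := (IsAdicComplete.map_algebraMap_iff J B).2 inferInstance
  have : Finite (A ⧸ J) :=
    Finite.of_equiv _ (PowerSeries.residueFieldOfPowerSeries (k := ZMod p)).symm.toEquiv
  have : Finite (B ⧸ I) := Module.finite_of_finite (A ⧸ J)
  have : FaithfulSMul A L := (faithfulSMul_iff_algebraMap_injective A L).2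
    ((algebraMap K L).injective.comp (IsFractionRing.injective A K))
  have : FaithfulSMul A B := (faithfulSMul_iff_algebraMap_injective A B).2 fun x y h =>
    FaithfulSMul.algebraMap_injective A L (congrArg (algebraMap B L) h)
  have : Module.IsTorsionFree A B :=
    Module.isTorsionFree_iff_algebraMap_injective.2 (FaithfulSMul.algebraMap_injective A B)
  have hfin : {P : Ideal B | P.IsMaximal}.Finite := by
    refine (IsDedekindDomain.primesOver_finite J B).subset fun P hP => ?_
    have hP' : P.IsMaximal := hP
    refine ⟨hP'.isPrime, ⟨?_⟩⟩
    exact (IsLocalRing.eq_maximalIdeal (Ideal.isMaximal_comap_of_isIntegral_of_isMaximal P)).symm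
  have : IsPrincipalIdealRing B := IsPrincipalIdealRing.of_finite_maximals hfin
  have hu : IsUnit (m : B) := by
    have h1 : IsUnit (m : ZMod p) := (ZMod.isUnit_iff_coprime m p).2 hmp
    have h2 := (h1.map (PowerSeries.C (R := ZMod p))).map (algebraMap A B)
    simpa using h2
  exact aux_main_s7 I hfin m hm hu
end

section
/- Let p be a prime and L = 𝔽_p((t)) the field of formal Laurent series over 𝔽_p. Then L has infinitely many distinct Galois extensions of degree p inside a fixed separable closure: the set of intermediate fields E of L^sep/L with [E : L] = p is infinite. In particular, the absolute Galois group of L has infinitely many open subgroups of index p, so L is not of type (F). -/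
open Polynomial IntermediateField

/-- If `σ` is a `K`-automorphism and `α ^ p - α ∈ K`, then `σ α = α + k` with `k` an integer. -/
lemma AS_exists_int {K M : Type*} [Field K] [Field M] [Algebra K M] (p : ℕ) [Fact p.Prime]
    [CharP M p] (a : K) (α : M) (h : α ^ p - α = algebraMap K M a) (σ : M ≃ₐ[K] M) :
    ∃ k : ℤ, σ α = α + (k : M) := by
  have h2 : (σ α) ^ p - σ α = algebraMap K M a := by
    rw [← map_pow, ← map_sub, h, σ.commutes]
  have h3 : (σ α - α) ^ p = σ α - α := by
    rw [sub_pow_char]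
    linear_combination h2 - h
  obtain ⟨k, hk⟩ := (mem_bot_iff_intCast p M).1
    ((Subfield.mem_bot_iff_pow_eq_self M p).2 h3)
  exact ⟨k, by rw [hk]; ring⟩

lemma AS_finrank {K M : Type*} [Field K] [Field M] [Algebra K M] [IsGalois K M]
    (p : ℕ) [Fact p.Prime]
    [CharP M p] (a : K) (α : M) (h : α ^ p - α = algebraMap K M a)
    (hα : ∀ x : K, algebraMap K M x ≠ α) :
    Module.finrank K K⟮α⟯ = p := by
  have hp : p.Prime := Fact.out
  have hint : IsIntegral K α := Algebra.IsIntegral.isIntegral α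
  rw [adjoin.finrank hint]
  apply le_antisymm
  · have hd : (X ^ p - (X + C a) : K[X]).natDegree = p := by
      rw [natDegree_sub_eq_left_of_natDegree_lt, natDegree_X_pow]
      rw [natDegree_X_pow, natDegree_X_add_C]
      exact hp.one_lt
    have hne : (X ^ p - (X + C a) : K[X]) ≠ 0 := by
      intro h0
      rw [h0, natDegree_zero] at hd
      exact hp.ne_zero hd.symm
    have := natDegree_le_of_dvd (minpoly.dvd K α (p := X ^ p - (X + C a)) (by
      simp only [map_sub, map_pow, aeval_X, map_add, aeval_C]
      linear_combination h)) hne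
    rwa [hd] at this
  · have hex : ∃ σ : M ≃ₐ[K] M, σ α ≠ α := by
      by_contra! hcon
      obtain ⟨x, hx⟩ := mem_bot.1 ((InfiniteGalois.mem_bot_iff_fixed α).2 hcon)
      exact hα x hx
    obtain ⟨σ, hσ⟩ := hex
    obtain ⟨k, hk⟩ := AS_exists_int p a α h σ
    have hk0 : (k : M) ≠ 0 := by
      intro h0
      rw [h0, add_zero] at hk
      exact hσ hk
    have hroot : ∀ n : ℕ, aeval (α + n * (k : M)) (minpoly K α) = 0 := by
      intro n
      induction n with
      | zero => simp
      | succ n ih =>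
        have h1 : σ (α + n * (k : M)) = α + (n + 1 : ℕ) * (k : M) := by
          rw [map_add, map_mul, map_natCast, map_intCast, hk]
          push_cast
          ring
        rw [← h1, aeval_algHom_apply, ih, map_zero]
    have hinj : Set.InjOn (fun n : ℕ => α + n * (k : M)) (Finset.range p : Set ℕ) := by
      intro m hm n hn hmn
      have h1 : (m : M) = n := mul_right_cancel₀ hk0 (add_left_cancel hmn)
      have h2 := (CharP.natCast_eq_natCast M p).1 h1
      exact Nat.ModEq.eq_of_lt_of_lt h2 (by simpa using hm) (by simpa using hn)
    classical
    have hcard := Finset.card_image_of_injOn hinj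
    rw [Finset.card_range] at hcard
    have hm0 : (minpoly K α).map (algebraMap K M) ≠ 0 :=
      (Polynomial.map_ne_zero_iff (algebraMap K M).injective).2 (minpoly.ne_zero hint)
    have := card_le_degree_of_subset_roots (p := (minpoly K α).map (algebraMap K M))
      (Z := (Finset.range p).image (fun n : ℕ => α + n * (k : M))) (by
        intro x hx
        obtain ⟨n, -, rfl⟩ := Finset.mem_image.1 (Finset.mem_val ▸ hx)
        rw [mem_roots hm0, IsRoot, eval_map_algebraMap]
        exact hroot n)
    rwa [hcard, natDegree_map] at this

lemma AS_eq {K M : Type*} [Field K] [Field M] [Algebra K M] [IsGalois K M]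
    (p : ℕ) [Fact p.Prime] [CharP M p] (a b : K) (α β : M)
    (h : α ^ p - α = algebraMap K M a) (h' : β ^ p - β = algebraMap K M b)
    (hα : ∀ x : K, algebraMap K M x ≠ α) (hE : K⟮α⟯ = K⟮β⟯) :
    ∃ (k l : ℤ) (x : K), (k : K) ≠ 0 ∧ x ^ p - x = k * b - l * a := by
  have hp : p.Prime := Fact.out
  have hex : ∃ σ : M ≃ₐ[K] M, σ α ≠ α := by
    by_contra! hcon
    obtain ⟨x, hx⟩ := mem_bot.1 ((InfiniteGalois.mem_bot_iff_fixed α).2 hcon)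
    exact hα x hx
  obtain ⟨σ, hσ⟩ := hex
  obtain ⟨k, hk⟩ := AS_exists_int p a α h σ
  obtain ⟨l, hl⟩ := AS_exists_int p b β h' σ
  have hk0 : (k : K) ≠ 0 := by
    intro h0
    have : (k : M) = 0 := by rw [← map_intCast (algebraMap K M), h0, map_zero]
    rw [this, add_zero] at hk
    exact hσ hk
  have hfix : σ (k * β - l * α) = k * β - l * α := by
    rw [map_sub, map_mul, map_mul, map_intCast, map_intCast, hk, hl]
    ring
  have hint : ∀ m : ℤ, (m : M) ^ p = m := fun m =>
    (Subfield.mem_bot_iff_pow_eq_self M p).1 ((mem_bot_iff_intCast p M).2 ⟨m, rfl⟩)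
  have hγ : ((k : M) * β - l * α) ^ p - (k * β - l * α) = algebraMap K M (k * b - l * a) := by
    rw [sub_pow_char, mul_pow, mul_pow, hint, hint]
    simp only [map_sub, map_mul, map_intCast, ← h, ← h']
    ring
  by_cases hx : ∃ x : K, algebraMap K M x = k * β - l * α
  · obtain ⟨x, hx⟩ := hx
    refine ⟨k, l, x, hk0, (algebraMap K M).injective ?_⟩
    rw [← hγ, ← hx, map_sub, map_pow]
  · push Not at hx
    exfalso
    have h1 := AS_finrank p _ _ hγ hx
    have h2 := AS_finrank p _ _ h hα
    have hle : K⟮(k * β - l * α : M)⟯ ≤ K⟮α⟯ := by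
      rw [adjoin_simple_le_iff]
      have hβ : β ∈ K⟮α⟯ := hE ▸ mem_adjoin_simple_self K β
      exact sub_mem (mul_mem (intCast_mem _ k) hβ)
        (mul_mem (intCast_mem _ l) (mem_adjoin_simple_self K α))
    have : FiniteDimensional K K⟮α⟯ := adjoin.finiteDimensional (Algebra.IsIntegral.isIntegral α)
    have heq := eq_of_le_of_finrank_eq hle (h1.trans h2.symm)
    have hmem : α ∈ K⟮(k * β - l * α : M)⟯ := heq ▸ mem_adjoin_simple_self K α
    have hle2 : K⟮(k * β - l * α : M)⟯ ≤ fixedField (Subgroup.zpowers σ) := by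
      rw [adjoin_simple_le_iff, mem_fixedField_iff]
      intro f hf
      have : Subgroup.zpowers σ ≤ MulAction.stabilizer (M ≃ₐ[K] M) (k * β - l * α : M) := by
        rw [Subgroup.zpowers_le]
        exact hfix
      exact this hf
    exact hσ ((mem_fixedField_iff _ _).1 (hle2 hmem) σ (Subgroup.mem_zpowers σ))

lemma laurent_no_root (p : ℕ) [Fact p.Prime] (m n : ℕ) (hm : ¬ p ∣ m) (hn : ¬ p ∣ n)
    (hmn : m ≠ n) (k l : ZMod p) (hk : k ≠ 0) (x : LaurentSeries (ZMod p))
    (hx : x ^ p - x = HahnSeries.single (-(n : ℤ)) k - HahnSeries.single (-(m : ℤ)) l) :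
    False := by
  have hp : p.Prime := Fact.out
  have hp1 : (1 : ℤ) < p := by exact_mod_cast hp.one_lt
  have hn0 : 0 < n := Nat.pos_of_ne_zero (by rintro rfl; exact hn (dvd_zero _))
  have hc : ∀ i : ℤ, (x ^ p).coeff i - x.coeff i =
      (HahnSeries.single (-(n : ℤ)) k : LaurentSeries (ZMod p)).coeff i
       - (HahnSeries.single (-(m : ℤ)) l : LaurentSeries (ZMod p)).coeff i := by
    intro i
    rw [← HahnSeries.coeff_sub, ← HahnSeries.coeff_sub, hx]
  have ho : (x ^ p).order = p * x.order := by
    rw [HahnSeries.order_pow, nsmul_eq_mul]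
  have hx0 : x ≠ 0 := by
    rintro rfl
    have := hc (-n)
    rw [zero_pow hp.ne_zero, HahnSeries.coeff_single_same, HahnSeries.coeff_single_of_ne (by omega)]
      at this
    simp at this
    exact hk this.symm
  rcases lt_or_ge x.order 0 with hv | hv
  · have h1 := hc (p * x.order)
    rw [HahnSeries.coeff_eq_zero_of_lt_order (x := x) (by nlinarith),
      HahnSeries.coeff_single_of_ne, HahnSeries.coeff_single_of_ne, ← ho, sub_zero, sub_zero,
      HahnSeries.coeff_order_eq_zero] at h1
    · exact hx0 (pow_eq_zero_iff hp.ne_zero |>.1 h1)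
    · intro h
      exact hm (Int.natCast_dvd_natCast.1 ((dvd_neg).1 ⟨_, h.symm⟩))
    · intro h
      exact hn (Int.natCast_dvd_natCast.1 ((dvd_neg).1 ⟨_, h.symm⟩))
  · have h1 := hc (-n)
    rw [HahnSeries.coeff_eq_zero_of_lt_order (x := x) (by omega),
      HahnSeries.coeff_eq_zero_of_lt_order (x := x ^ p) (by rw [ho]; nlinarith),
      HahnSeries.coeff_single_same, HahnSeries.coeff_single_of_ne (by omega)] at h1
    simp at h1
    exact hk h1.symm

/-- The Laurent series field `L = 𝔽_p((t))` has infinitely many degree-`p` extensions inside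
a fixed separable closure: the set of intermediate fields of `L^sep/L` of degree `p` over `L`
is infinite. -/
theorem laurentSeries_zmod_infinitely_many_degree_p_extensions
    (p : ℕ) [Fact p.Prime] :
    {E : IntermediateField (LaurentSeries (ZMod p))
        (separableClosure (LaurentSeries (ZMod p)) (AlgebraicClosure (LaurentSeries (ZMod p)))) |
      Module.finrank (LaurentSeries (ZMod p)) E = p}.Infinite := by
  have hp : p.Prime := Fact.out
  let K := LaurentSeries (ZMod p)
  let M := separableClosure K (AlgebraicClosure K)
  have : CharP K p := charP_of_injective_ringHom
    (f := (HahnSeries.C : ZMod p →+* K)) HahnSeries.C_injective p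
  have : CharP M p := charP_of_injective_algebraMap (algebraMap K M).injective p
  have : IsSepClosed M := (separableClosure.isSepClosure K (AlgebraicClosure K)).sep_closed
  have hint : ∀ (k : ℤ) (n : ℤ), (k : K) * HahnSeries.single n (1 : ZMod p)
      = HahnSeries.single n (k : ZMod p) := by
    intro k n
    rw [← map_intCast (HahnSeries.C : ZMod p →+* K), HahnSeries.C_mul_eq_smul]
    ext i
    simp [HahnSeries.coeff_single]
  have hcast : ∀ k : ℤ, (k : K) ≠ 0 → (k : ZMod p) ≠ 0 := by
    intro k hk h0
    apply hk
    rw [← map_intCast (HahnSeries.C : ZMod p →+* K), h0, map_zero]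
  have hdvd : ∀ n : ℕ, ¬ p ∣ p * n + 1 := by
    intro n h
    exact hp.one_lt.ne' (Nat.dvd_one.1 ((Nat.dvd_add_right (dvd_mul_right p n)).1 h))
  let a : ℕ → K := fun n => HahnSeries.single (-((p * n + 1 : ℕ) : ℤ)) (1 : ZMod p)
  have hα : ∀ n, ∃ α : M, α ^ p - α = algebraMap K M (a n) := by
    intro n
    obtain ⟨α, h⟩ := IsSepClosed.exists_root_C_mul_X_pow_add_C_mul_X_add_C' p p
      (1 : M) (-1) (-algebraMap K M (a n)) dvd_rfl hp.two_le (by simp)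
    exact ⟨α, by linear_combination h⟩
  choose α hα using hα
  have hnot : ∀ n, ∀ x : K, algebraMap K M x ≠ α n := by
    intro n x hx
    have h1 : x ^ p - x = a n := by
      apply (algebraMap K M).injective
      rw [← hα n, ← hx, map_sub, map_pow]
    refine laurent_no_root p (p * (n + 1) + 1) (p * n + 1) (hdvd _) (hdvd _) ?_ 1 0 one_ne_zero x ?_
    · have := hp.pos
      nlinarith
    · rw [h1, HahnSeries.single_eq_zero, sub_zero]
  refine Set.infinite_of_injective_forall_mem (f := fun n : ℕ => K⟮α n⟯) ?_ ?_
  · intro m n hmn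
    by_contra hne
    obtain ⟨k, l, x, hk, hx⟩ := AS_eq p (a m) (a n) (α m) (α n) (hα m) (hα n) (hnot m) hmn
    rw [hint, hint] at hx
    refine laurent_no_root p (p * m + 1) (p * n + 1) (hdvd _) (hdvd _) ?_ _ _ (hcast k hk) x hx
    intro h
    exact hne (Nat.eq_of_mul_eq_mul_left hp.pos (Nat.succ_injective h))
  · intro n
    exact AS_finrank p (a n) (α n) (hα n) (hnot n)
end
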